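/- There exists a Hilbert space $X$ and an invertible bounded linear operator $T : X \to X$ with bounded inverse such that $T\vert_{CR(T)}$ is not a chain recurrent operator; moreover $CR(T\vert_{CR(T)}) = \{0\}$ while $CR(T) \ne \{0\}$. -/

import Mathlib

/-- A δ-chain for `T` from `f` to `g`: a finite sequence `(u l)_{l=0}^m`, `m ≥ 1`,
with `u 0 = f`, `u m = g`, and `‖u l - T (u (l-1))‖ < δ` for `1 ≤ l ≤ m`. -/
def IsDeltaChain {X : Type*} [NormedAddCommGroup X] [NormedSpace ℂ X]
    (T : X →L[ℂ] X) (δ : ℝ) (f g : X) : Prop :=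
  ∃ (m : ℕ) (u : ℕ → X), 1 ≤ m ∧ u 0 = f ∧ u m = g ∧
    ∀ l, 1 ≤ l → l ≤ m → ‖u l - T (u (l - 1))‖ < δ

/-- `f` is a chain recurrent vector for `T`. -/
def ChainRecVec {X : Type*} [NormedAddCommGroup X] [NormedSpace ℂ X]
    (T : X →L[ℂ] X) (f : X) : Prop :=
  ∀ δ : ℝ, 0 < δ → IsDeltaChain T δ f f

/-- `f` is chain recurrent for the restriction of `T` to the subset `S`
(all points of the chain are required to lie in `S`). -/
def RelChainRecVec {X : Type*} [NormedAddCommGroup X] [NormedSpace ℂ X]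
    (T : X →L[ℂ] X) (S : Set X) (f : X) : Prop :=
  ∀ δ : ℝ, 0 < δ → ∃ (m : ℕ) (u : ℕ → X), 1 ≤ m ∧ (∀ l ≤ m, u l ∈ S) ∧
    u 0 = f ∧ u m = f ∧ ∀ l, 1 ≤ l → l ≤ m → ‖u l - T (u (l - 1))‖ < δ

open scoped ENNReal

noncomputable section

namespace CRex

/-- Index set for the branches. -/
abbrev Idx := ℕ × ℤ

/-- The Hilbert space of branches. -/
abbrev Z := lp (fun _ : Idx => ℂ) 2

/-- The full Hilbert space. -/
abbrev X := WithLp 2 (Z × ℂ)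

lemma two_pos' : 0 < (2 : ℝ≥0∞).toReal := by simp

lemma bound_aux (s : Idx ≃ Idx) (a : Idx → ℂ) (ha : ∀ i, ‖a i‖ ≤ 8) (x : Z) (S : Finset Idx) :
    ∑ i ∈ S, ‖a i * x (s i)‖ ^ (2 : ℝ≥0∞).toReal ≤ (8 * ‖x‖) ^ (2 : ℝ≥0∞).toReal := by
  have h := lp.sum_rpow_le_norm_rpow two_pos' x (S.map s.toEmbedding)
  rw [Finset.sum_map] at h
  simp only [ENNReal.toReal_ofNat, Real.rpow_ofNat, Equiv.coe_toEmbedding] at h ⊢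
  calc ∑ i ∈ S, ‖a i * x (s i)‖ ^ 2 ≤ ∑ i ∈ S, 64 * ‖x (s i)‖ ^ 2 := by
        apply Finset.sum_le_sum
        intro i _
        rw [norm_mul, mul_pow]
        have := ha i
        have h0 := norm_nonneg (a i)
        gcongr
        nlinarith
    _ = 64 * ∑ i ∈ S, ‖x (s i)‖ ^ 2 := by rw [Finset.mul_sum]
    _ ≤ 64 * ‖x‖ ^ 2 := by gcongr
    _ = (8 * ‖x‖) ^ 2 := by ring

/-- Weighted composition operator. -/
def W (s : Idx ≃ Idx) (a : Idx → ℂ) (ha : ∀ i, ‖a i‖ ≤ 8) : Z →L[ℂ] Z :=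
  LinearMap.mkContinuous
    { toFun := fun x => ⟨fun i => a i * x (s i), memℓp_gen' (bound_aux s a ha x)⟩
      map_add' := by
        intro x y
        ext i
        exact mul_add _ _ _
      map_smul' := by
        intro c x
        ext i
        simp
        ring } 8
    (fun x => lp.norm_le_of_forall_sum_le two_pos' (by positivity) (bound_aux s a ha x))

lemma W_apply (s : Idx ≃ Idx) (a : Idx → ℂ) (ha : ∀ i, ‖a i‖ ≤ 8) (x : Z) (i : Idx) :
    W s a ha x i = a i * x (s i) := rfl

/-- The shift. -/
def sh : Idx ≃ Idx := (Equiv.refl ℕ).prodCongr (Equiv.addRight (1 : ℤ))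

lemma sh_apply (k : ℕ) (j : ℤ) : sh (k, j) = (k, j + 1) := rfl
lemma sh_symm_apply (k : ℕ) (j : ℤ) : sh.symm (k, j) = (k, j - 1) := rfl

/-- The weights. -/
def wt (i : Idx) : ℂ := if 1 ≤ i.2 ∧ i.2 ≤ i.1 then 8 else 1 / 2

lemma wt_ne (i : Idx) : wt i ≠ 0 := by
  unfold wt; split_ifs <;> norm_num

lemma wt_le (i : Idx) : ‖wt i‖ ≤ 8 := by
  unfold wt; split_ifs <;> norm_num

lemma wt_inv_le (i : Idx) : ‖(wt i)⁻¹‖ ≤ 8 := by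
  unfold wt; split_ifs <;> norm_num

/-- The operator on the branches. -/
def B : Z ≃L[ℂ] Z :=
  ContinuousLinearEquiv.equivOfInverse
    (W sh (fun i => wt (sh i)) (fun i => wt_le _))
    (W sh.symm (fun i => (wt i)⁻¹) (fun i => wt_inv_le _))
    (by
      intro x
      ext i
      simp [W_apply, wt_ne])
    (by
      intro x
      ext i
      simp [W_apply, wt_ne])

lemma B_apply (x : Z) (k : ℕ) (j : ℤ) : B x (k, j) = wt (k, j + 1) * x (k, j + 1) := rfl

/-- Coefficients of the coupling functional. -/
def dcoef (i : Idx) : ℂ := if i.2 = 0 then (1 / 2) ^ i.1 else 0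

lemma dcoef_mem : Memℓp dcoef 2 := by
  apply memℓp_gen
  have hinj : Function.Injective (fun k : ℕ => ((k, 0) : Idx)) := by
    intro a b h
    simpa using h
  rw [← hinj.summable_iff]
  · have : Summable (fun k : ℕ => ((1 / 4 : ℝ)) ^ k) :=
      summable_geometric_of_lt_one (by norm_num) (by norm_num)
    refine this.congr ?_
    intro k
    simp [dcoef]
    rw [← pow_mul, mul_comm, pow_mul]
    norm_num
  · rintro ⟨k, j⟩ h
    have hj : j ≠ 0 := by
      rintro rfl
      exact h ⟨k, rfl⟩
    simp [dcoef, hj]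

/-- The coupling functional. -/
def phi : Z →L[ℂ] ℂ := innerSL ℂ (⟨dcoef, dcoef_mem⟩ : Z)

lemma phi_single (i : Idx) (a : ℂ) : phi (lp.single 2 i a) = dcoef i * a := by
  rw [phi, innerSL_apply_apply, lp.inner_single_right]
  have : (starRingEnd ℂ) (dcoef i) = dcoef i := by
    unfold dcoef
    split_ifs
    · rw [map_pow, map_div₀, map_one, Complex.conj_ofNat]
    · simp
  change a * (starRingEnd ℂ) (dcoef i) = _
  rw [this, mul_comm]

/-- Multiplication by two. -/
def dbl : ℂ ≃L[ℂ] ℂ := ContinuousLinearEquiv.smulLeft (Units.mk0 (2 : ℂ) two_ne_zero)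

/-- The operator. -/
def T : X ≃L[ℂ] X :=
  ((WithLp.prodContinuousLinearEquiv 2 ℂ Z ℂ).trans (B.skewProd dbl phi)).trans
    (WithLp.prodContinuousLinearEquiv 2 ℂ Z ℂ).symm

lemma T_fst (x : X) : (T x).fst = B x.fst := rfl
lemma T_snd (x : X) : (T x).snd = 2 * x.snd + phi x.fst := rfl

/-- Elementary vectors. -/
def E (k : ℕ) (j : ℤ) (a t : ℂ) : X := WithLp.toLp 2 (lp.single 2 (k, j) a, t)

lemma X_ext {x y : X} (h1 : x.fst = y.fst) (h2 : x.snd = y.snd) : x = y := by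
  apply WithLp.ofLp_injective
  exact Prod.ext h1 h2

lemma T_E (k : ℕ) (j : ℤ) (a t : ℂ) :
    T (E k j a t) = E k (j - 1) (wt (k, j) * a) (2 * t + dcoef (k, j) * a) := by
  apply X_ext
  · rw [T_fst]
    ext ⟨k', j'⟩
    rw [B_apply]
    change wt (k', j' + 1) * (Pi.single (M := fun _ : Idx => ℂ) (k, j) a : Idx → ℂ) (k', j' + 1) =
      (Pi.single (M := fun _ : Idx => ℂ) (k, j - 1) (wt (k, j) * a) : Idx → ℂ) (k', j')
    by_cases h : (k', j' + 1) = (k, j)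
    · have h' : (k', j') = (k, j - 1) := by
        simp only [Prod.mk.injEq] at h ⊢
        omega
      rw [h, h']
      simp
    · have h' : (k', j') ≠ (k, j - 1) := by
        simp only [ne_eq, Prod.mk.injEq] at h ⊢
        omega
      simp only [Pi.single_eq_of_ne h, Pi.single_eq_of_ne h', mul_zero]
  · rw [T_snd]
    change 2 * t + phi (lp.single 2 (k, j) a) = 2 * t + dcoef (k, j) * a
    rw [phi_single]

/-- One step of a chain. -/
def step (δ : ℝ) (f g : X) : Prop := ‖g - T f‖ < δ

lemma chain_of_transGen {δ : ℝ} {f g : X} (h : Relation.TransGen (step δ) f g) :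
    IsDeltaChain (T : X →L[ℂ] X) δ f g := by
  induction h with
  | @single b hb =>
    refine ⟨1, fun l => if l = 0 then f else b, le_rfl, by simp, by simp, ?_⟩
    intro l h1 h2
    obtain rfl : l = 1 := le_antisymm h2 h1
    simpa [step] using hb
  | @tail b c _ hbc ih =>
    obtain ⟨m, u, hm, h0, hm', hu⟩ := ih
    refine ⟨m + 1, fun l => if l ≤ m then u l else c, by omega, by simp [h0], by simp, ?_⟩
    intro l h1 h2
    by_cases hl : l ≤ m
    · have : l - 1 ≤ m := by omega
      simp only [hl, this, if_true]
      exact hu l h1 hl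
    · obtain rfl : l = m + 1 := by omega
      simpa [hm', step] using hbc

lemma step_T {δ : ℝ} (hδ : 0 < δ) {f g : X} (h : T f = g) : step δ f g := by
  simp [step, h, hδ]

lemma small (c δ : ℝ) (hδ : 0 < δ) : ∃ n : ℕ, c * (1 / 2) ^ n < δ := by
  have h : Filter.Tendsto (fun n : ℕ => c * (1 / 2 : ℝ) ^ n) Filter.atTop (nhds (c * 0)) :=
    (tendsto_pow_atTop_nhds_zero_of_lt_one (by norm_num) (by norm_num)).const_mul c
  rw [mul_zero] at h
  exact (h.eventually (gt_mem_nhds hδ)).exists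

lemma phaseA {δ : ℝ} (hδ : 0 < δ) (k : ℕ) (a t : ℂ) (i : ℕ) (hi : i ≤ k) :
    Relation.ReflTransGen (step δ) (E k k a t) (E k ((k : ℤ) - i) (8 ^ i * a) (2 ^ i * t)) := by
  induction i with
  | zero => simpa using Relation.ReflTransGen.refl
  | succ i ih =>
    refine (ih (by omega)).tail (step_T hδ ?_)
    rw [T_E]
    have h1 : wt (k, (k : ℤ) - i) = 8 := by
      unfold wt
      rw [if_pos]
      constructor <;> simp
      omega
    have h2 : dcoef (k, (k : ℤ) - i) = 0 := by
      unfold dcoef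
      rw [if_neg]
      simp only
      omega
    rw [h1, h2]
    congr 1
    · push_cast; ring
    · ring
    · ring

lemma phaseB {δ : ℝ} (hδ : 0 < δ) (k : ℕ) (b : ℂ) (i : ℕ) :
    Relation.ReflTransGen (step δ) (E k (-1) b 0) (E k (-1 - i) (b * (1 / 2) ^ i) 0) := by
  induction i with
  | zero => simpa using Relation.ReflTransGen.refl
  | succ i ih =>
    refine ih.tail (step_T hδ ?_)
    rw [T_E]
    have h1 : wt (k, -1 - (i : ℤ)) = 1 / 2 := by
      unfold wt
      rw [if_neg]
      simp only
      omega
    have h2 : dcoef (k, -1 - (i : ℤ)) = 0 := by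
      unfold dcoef
      rw [if_neg]
      simp only
      omega
    rw [h1, h2]
    congr 1
    · push_cast; ring
    · ring
    · ring

lemma E_zero (k k' : ℕ) (j j' : ℤ) (t : ℂ) : E k j 0 t = E k' j' 0 t := by
  simp [E]

lemma T_E0 (t : ℂ) : T (E 0 0 0 t) = E 0 0 0 (2 * t) := by
  rw [T_E, mul_zero, mul_zero, add_zero, E_zero 0 0 _ 0]

lemma phaseC {δ : ℝ} (hδ : 0 < δ) (n : ℕ) :
    Relation.ReflTransGen (step δ) (E 0 0 0 ((1 / 2) ^ n)) (E 0 0 0 1) := by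
  induction n with
  | zero => simpa using Relation.ReflTransGen.refl
  | succ n ih =>
    refine ih.head (step_T hδ ?_)
    rw [T_E0]
    congr 1
    ring

lemma norm_E (k : ℕ) (j : ℤ) (a t : ℂ) : ‖E k j a t‖ ≤ ‖a‖ + ‖t‖ := by
  have h : E k j a t = WithLp.toLp 2 (lp.single 2 (k, j) a, 0) + WithLp.toLp 2 (0, t) := by
    apply X_ext <;> simp [E]
  rw [h]
  refine (norm_add_le _ _).trans ?_
  rw [WithLp.norm_toLp_fst, WithLp.norm_toLp_snd, lp.norm_single (by norm_num)]

lemma E_sub (k : ℕ) (j : ℤ) (a b s t : ℂ) :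
    E k j a s - E k j b t = E k j (a - b) (s - t) := by
  apply X_ext
  · simp [E, lp.single_sub]
  · simp [E]

lemma y_rec : ChainRecVec (T : X →L[ℂ] X) (E 0 0 0 1) := by
  intro δ hδ
  apply chain_of_transGen
  obtain ⟨k, hk⟩ := small 4 δ hδ
  set a : ℂ := -4 * (1 / 2) ^ k with ha
  set b : ℂ := 1 / 2 * (8 ^ k * a) with hb
  obtain ⟨i, hi⟩ := small ‖b‖ (δ / 2) (by positivity)
  obtain ⟨n, hn⟩ := small 1 (δ / 2) (by positivity)
  have s1 : step δ (E 0 0 0 1) (E k k a 2) := by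
    unfold step
    rw [T_E0, E_zero 0 k 0 k, E_sub]
    refine (norm_E _ _ _ _).trans_lt ?_
    simpa [ha] using hk
  have sA := phaseA hδ k a 2 k le_rfl
  have s2 : step δ (E k ((k : ℤ) - k) (8 ^ k * a) (2 ^ k * 2)) (E k (-1) b 0) := by
    apply step_T hδ
    rw [T_E, sub_self]
    have h1 : wt (k, 0) = 1 / 2 := by
      unfold wt
      rw [if_neg]
      simp
    have h2 : dcoef (k, 0) = (1 / 2) ^ k := by
      simp [dcoef]
    rw [h1, h2]
    congr 1
    have h8 : (8 : ℂ) ^ k = 2 ^ k * 2 ^ k * 2 ^ k := by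
      rw [← mul_pow, ← mul_pow]; norm_num
    have h3 : (2 : ℂ) ^ k * (1 / 2) ^ k = 1 := by
      rw [← mul_pow]; norm_num
    rw [ha, h8]
    linear_combination (-4 * 2 ^ k * (2 ^ k * (1 / 2) ^ k + 1) : ℂ) * h3
  have sB := phaseB hδ k b i
  have s3 : step δ (E k (-1 - i) (b * (1 / 2) ^ i) 0) (E 0 0 0 ((1 / 2) ^ n)) := by
    unfold step
    have h1 : wt (k, -1 - (i : ℤ)) = 1 / 2 := by
      unfold wt
      rw [if_neg]
      simp only
      omega
    rw [T_E, E_zero 0 k 0 (-1 - i - 1), E_sub, h1]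
    have h2 : dcoef (k, -1 - (i : ℤ)) = 0 := by
      unfold dcoef
      rw [if_neg]
      simp only
      omega
    rw [h2]
    refine (norm_E _ _ _ _).trans_lt ?_
    have e1 : ‖(0 : ℂ) - 1 / 2 * (b * (1 / 2) ^ i)‖ = 1 / 2 * (‖b‖ * (1 / 2) ^ i) := by
      simp
    have e2 : ‖((1 / 2) ^ n : ℂ) - (2 * 0 + 0 * (b * (1 / 2) ^ i))‖ = (1 / 2) ^ n := by
      simp
    rw [e1, e2]
    have : 0 ≤ ‖b‖ * (1 / 2) ^ i := by positivity
    linarith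
  have sC := phaseC hδ n
  exact ((((Relation.TransGen.single s1).trans_left sA).tail s2).trans_left sB).tail s3
    |>.trans_left sC

lemma contract {α : Type*} (P : Set α) (a : α → ℝ) (C δ : ℝ) (hC : ∀ x ∈ P, a x ≤ C)
    (h : ∀ x ∈ P, ∃ y ∈ P, a x ≤ a y / 2 + δ) (x : α) (hx : x ∈ P) : a x ≤ 2 * δ := by
  have key : ∀ n : ℕ, ∀ x ∈ P, a x ≤ (C - 2 * δ) * (1 / 2) ^ n + 2 * δ := by
    intro n
    induction n with
    | zero => intro x hx; simpa using hC x hx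
    | succ n ih =>
      intro x hx
      obtain ⟨y, hy, hxy⟩ := h x hx
      have := ih y hy
      rw [pow_succ]
      linarith
  by_contra hlt
  push Not at hlt
  obtain ⟨n, hn⟩ := small (C - 2 * δ) (a x - 2 * δ) (by linarith)
  have := key n x hx
  linarith

lemma back (k : ℕ) (j : ℤ) : ∃ K : ℝ, 0 ≤ K ∧ ∀ (P : Set X) (C δ : ℝ), 0 < δ →
    (∀ x ∈ P, ‖x‖ ≤ C) → (∀ x ∈ P, ∃ y ∈ P, ‖x - T y‖ < δ) →
    ∀ x ∈ P, ‖x.fst (k, j)‖ ≤ K * δ := by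
  have coord : ∀ (x y : X) (δ : ℝ) (j : ℤ), ‖x - T y‖ < δ →
      ‖x.fst (k, j)‖ ≤ ‖wt (k, j + 1)‖ * ‖y.fst (k, j + 1)‖ + δ := by
    intro x y δ j h
    have h1 : ‖(x - T y).fst (k, j)‖ ≤ ‖x - T y‖ :=
      (lp.norm_apply_le_norm (by norm_num) _ _).trans (WithLp.norm_fst_le _ _)
    have h2 : (x - T y).fst (k, j) = x.fst (k, j) - wt (k, j + 1) * y.fst (k, j + 1) := by
      rw [← B_apply, ← T_fst]
      rfl
    rw [h2] at h1
    have h3 := norm_sub_norm_le (x.fst (k, j)) (wt (k, j + 1) * y.fst (k, j + 1))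
    rw [norm_mul] at h3
    linarith
  have top : ∀ j : ℤ, (k : ℤ) ≤ j → ∃ K : ℝ, 0 ≤ K ∧ ∀ (P : Set X) (C δ : ℝ), 0 < δ →
      (∀ x ∈ P, ‖x‖ ≤ C) → (∀ x ∈ P, ∃ y ∈ P, ‖x - T y‖ < δ) →
      ∀ x ∈ P, ‖x.fst (k, j)‖ ≤ K * δ := by
    intro j hj
    refine ⟨2, by norm_num, ?_⟩
    intro P C δ hδ hC h x hx
    refine contract (α := X × ℤ) {p | p.1 ∈ P ∧ (k : ℤ) ≤ p.2} (fun p => ‖p.1.fst (k, p.2)‖) C δ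
      ?_ ?_ (x, j) ⟨hx, hj⟩
    · rintro ⟨x, j⟩ ⟨hx, _⟩
      exact ((lp.norm_apply_le_norm (by norm_num) _ _).trans
        (WithLp.norm_fst_le _ _)).trans (hC x hx)
    · rintro ⟨x, j⟩ ⟨hx, hj⟩
      obtain ⟨y, hy, hxy⟩ := h x hx
      simp only at hj
      refine ⟨(y, j + 1), ⟨hy, by simp only; omega⟩, ?_⟩
      have h1 := coord x y δ j hxy
      have h2 : wt (k, j + 1) = 1 / 2 := by
        unfold wt
        rw [if_neg]
        simp only
        omega
      rw [h2] at h1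
      have h3 : ‖(1 / 2 : ℂ)‖ = 1 / 2 := by simp
      rw [h3] at h1
      simp only
      linarith
  have down : ∀ n : ℕ, ∃ K : ℝ, 0 ≤ K ∧ ∀ (P : Set X) (C δ : ℝ), 0 < δ →
      (∀ x ∈ P, ‖x‖ ≤ C) → (∀ x ∈ P, ∃ y ∈ P, ‖x - T y‖ < δ) →
      ∀ x ∈ P, ‖x.fst (k, (k : ℤ) - n)‖ ≤ K * δ := by
    intro n
    induction n with
    | zero => simpa using top k le_rfl
    | succ n ih =>
      obtain ⟨K, hK, ih⟩ := ih
      refine ⟨8 * K + 1, by positivity, ?_⟩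
      intro P C δ hδ hC h x hx
      obtain ⟨y, hy, hxy⟩ := h x hx
      have h1 := coord x y δ ((k : ℤ) - (n + 1 : ℕ)) hxy
      have h2 := ih P C δ hδ hC h y hy
      have e : (k : ℤ) - (n + 1 : ℕ) + 1 = (k : ℤ) - n := by push_cast; ring
      rw [e] at h1
      have h3 := mul_le_mul (wt_le (k, (k : ℤ) - n)) h2 (norm_nonneg _) (by norm_num)
      linarith
  rcases le_total (k : ℤ) j with hj | hj
  · exact top j hj
  · have := down ((k : ℤ) - j).toNat
    have e : (k : ℤ) - (((k : ℤ) - j).toNat : ℤ) = j := by omega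
    rwa [e] at this

lemma bdd (m : ℕ) (u : ℕ → X) : ∃ C, ∀ x ∈ Set.image u {l | l ≤ m}, ‖x‖ ≤ C := by
  have : (Set.image u {l | l ≤ m}).Finite := (Set.finite_le_nat m).image u
  exact this.isBounded.exists_norm_le

lemma fst_zero {f : X} (hf : ChainRecVec (T : X →L[ℂ] X) f) : f.fst = 0 := by
  ext ⟨k, j⟩
  obtain ⟨K, hK, h⟩ := back k j
  by_contra hne
  have hpos : 0 < ‖f.fst (k, j)‖ := norm_pos_iff.mpr hne
  have hδ : 0 < ‖f.fst (k, j)‖ / (K + 1) := by positivity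
  obtain ⟨m, u, hm, h0, hm', hu⟩ := hf _ hδ
  obtain ⟨C, hC⟩ := bdd m u
  have := h (Set.image u {l | l ≤ m}) C _ hδ hC ?_ f ⟨0, by simp, h0⟩
  · rw [mul_div_assoc', le_div_iff₀ (by positivity)] at this
    nlinarith
  · rintro _ ⟨l, hl, rfl⟩
    simp only [Set.mem_ofPred_eq] at hl
    rcases Nat.eq_zero_or_pos l with rfl | hl0
    · refine ⟨u (m - 1), ⟨m - 1, by simp, rfl⟩, ?_⟩
      have h1 := hu m hm le_rfl
      rw [hm', ← h0] at h1
      rw [← h0]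
      exact h1
    · exact ⟨u (l - 1), ⟨l - 1, by simp only [Set.mem_ofPred_eq]; omega, rfl⟩, hu l hl0 hl⟩

lemma rel_zero {f : X}
    (hf : RelChainRecVec (T : X →L[ℂ] X) {g : X | ChainRecVec (T : X →L[ℂ] X) g} f) :
    f.snd = 0 := by
  by_contra hne
  have hpos : 0 < ‖f.snd‖ := norm_pos_iff.mpr hne
  obtain ⟨m, u, hm, hS, h0, hm', hu⟩ := hf (‖f.snd‖ / 2) (by positivity)
  obtain ⟨C, hC⟩ := bdd m u
  have key : ∀ l, l < m → ‖(u l).snd‖ ≤ ‖(u (l + 1)).snd‖ / 2 + ‖f.snd‖ / 4 := by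
    intro l hl
    have h1 := hu (l + 1) (by omega) (by omega)
    have h2 := (WithLp.norm_snd_le _ _).trans_lt h1
    have h3 : (u (l + 1) - T (u l)).snd = (u (l + 1)).snd - 2 * (u l).snd := by
      have : (u (l + 1) - T (u l)).snd = (u (l + 1)).snd - (T (u l)).snd := rfl
      rw [this, T_snd, fst_zero (hS l hl.le), map_zero, add_zero]
    change ‖(u (l + 1) - T (u l)).snd‖ < _ at h2
    rw [h3] at h2
    have h4 := norm_sub_norm_le (2 * (u l).snd) ((u (l + 1)).snd)
    rw [norm_sub_rev, norm_mul] at h4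
    simp only [Complex.norm_ofNat] at h4
    linarith
  have := contract (Set.image u {l | l ≤ m}) (fun x => ‖x.snd‖) C (‖f.snd‖ / 4) ?_ ?_ f ⟨0, by simp, h0⟩
  · linarith
  · intro x hx
    exact (WithLp.norm_snd_le _ _).trans (hC x hx)
  · rintro _ ⟨l, hl, rfl⟩
    simp only [Set.mem_ofPred_eq] at hl
    rcases hl.lt_or_eq with hl | rfl
    · exact ⟨u (l + 1), ⟨l + 1, hl, rfl⟩, key l hl⟩
    · refine ⟨u 1, ⟨1, hm, rfl⟩, ?_⟩
      rw [hm', ← h0]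
      have := key 0 (by omega)
      rwa [h0] at this ⊢

lemma zero_rec : ChainRecVec (T : X →L[ℂ] X) 0 := by
  intro δ hδ
  exact ⟨1, fun _ => 0, le_rfl, rfl, rfl, fun l _ _ => by simpa using hδ⟩

end CRex

end

theorem stmt_11 :
    ∃ (X : Type) (_ : NormedAddCommGroup X) (_ : InnerProductSpace ℂ X)
      (_ : CompleteSpace X) (T : X ≃L[ℂ] X),
      {f : X | ChainRecVec (T : X →L[ℂ] X) f ∧
          RelChainRecVec (T : X →L[ℂ] X) {g : X | ChainRecVec (T : X →L[ℂ] X) g} f} = {0} ∧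
      {f : X | ChainRecVec (T : X →L[ℂ] X) f} ≠ {0} := by
  refine ⟨CRex.X, inferInstance, inferInstance, inferInstance, CRex.T, ?_, ?_⟩
  · ext f
    simp only [Set.mem_ofPred_eq, Set.mem_singleton_iff]
    constructor
    · rintro ⟨h1, h2⟩
      exact CRex.X_ext (CRex.fst_zero h1) (CRex.rel_zero h2)
    · rintro rfl
      refine ⟨CRex.zero_rec, ?_⟩
      intro δ hδ
      exact ⟨1, fun _ => 0, le_rfl, fun _ _ => CRex.zero_rec, rfl, rfl,
        fun l _ _ => by simpa using hδ⟩
  · intro h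
    have hy : CRex.E 0 0 0 1 ∈ ({0} : Set CRex.X) := h ▸ CRex.y_rec
    rw [Set.mem_singleton_iff] at hy
    have : (CRex.E 0 0 0 1).snd = (0 : CRex.X).snd := by rw [hy]
    simp [CRex.E] at this
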